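/- Let X be a graph-like continuum in which every cut E(A,B) induced by a separation (A,B) of the vertex set V has even cardinality. Then the edges of X can be decomposed into edge-disjoint circles: there is a family (C_i) of circles in X, no two of which contain a common edge, such that every edge of X is contained in exactly one C_i. -/

import Mathlib

open Set Topology Filter Function

universe u

/-- A compact graph-like space structure on a topological space `X`:
a closed zero-dimensional vertex set `V` together with an index type `E`
(carrying the discrete topology) such that `X \ V ≅ E × (0,1)`. -/
structure GraphLike (X : Type u) [TopologicalSpace X] where
  V : Set X
  closedV : IsClosed V
  zeroDimV : TotallyDisconnectedSpace V
  E : Type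
  homeo :
    letI : TopologicalSpace E := ⊥
    Nonempty ((Vᶜ : Set X) ≃ₜ (E × ↥(Set.Ioo (0 : ℝ) 1)))

variable {X : Type u} [TopologicalSpace X]

/-- An edge of a graph-like space: a connected component of `X \ V`. -/
def GraphLike.IsEdge (G : GraphLike X) (e : Set X) : Prop :=
  ∃ x, x ∈ (G.V)ᶜ ∧ e = connectedComponentIn (G.V)ᶜ x

/-- A subset of the vertex set which is clopen in the subspace `V`. -/
def GraphLike.ClopenIn (G : GraphLike X) (C : Set X) : Prop :=
  C ⊆ G.V ∧ IsClosed C ∧ IsClosed (G.V \ C)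

/-- A separation of a graph-like space: a partition of the vertex set into
two disjoint clopen pieces. -/
structure GraphLike.Separation (G : GraphLike X) where
  A : Set X
  B : Set X
  clopenA : G.ClopenIn A
  clopenB : G.ClopenIn B
  disjoint : A ∩ B = ∅
  union : A ∪ B = G.V

/-- The cut induced by a pair of vertex sets: all edges whose closure meets both. -/
def GraphLike.cut (G : GraphLike X) (A B : Set X) : Set (Set X) :=
  {e | G.IsEdge e ∧ (closure e ∩ A).Nonempty ∧ (closure e ∩ B).Nonempty}

/-- A cut is even if it is finite of even cardinality. -/
def GraphLike.EvenCut (G : GraphLike X) (A B : Set X) : Prop :=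
  (G.cut A B).Finite ∧ Even (G.cut A B).ncard


section Alg
variable {E : Type} {P : Type u} [AddCommGroup P] [Module (ZMod 2) P]

/-- pairing with a set -/
noncomputable def glPr (D : Set E) : (E →₀ ZMod 2) →ₗ[ZMod 2] ZMod 2 :=
  Finsupp.linearCombination (ZMod 2) (D.indicator (1 : E → ZMod 2))

lemma glPr_single (D : Set E) (i : E) (z : ZMod 2) :
    glPr D (Finsupp.single i z) = z * D.indicator (1 : E → ZMod 2) i := by
  simp [glPr]

lemma glPr_apply (D : Set E) (x : E →₀ ZMod 2) :
    glPr D x = ∑ i ∈ x.support, x i * D.indicator (1 : E → ZMod 2) i := by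
  simp [glPr, Finsupp.linearCombination_apply, Finsupp.sum]

lemma glPr_of_single (D : Set E) (x : E →₀ ZMod 2) (e : E) (he : e ∈ D)
    (h : ∀ i ∈ D, i ≠ e → x i = 0) : glPr D x = x e := by
  rw [glPr_apply, Finset.sum_eq_single e]
  · simp [he]
  · intro i _ hi
    by_cases hD : i ∈ D
    · simp [h i hD hi]
    · simp [hD]
  · intro h; simp at h; simp [h]

lemma glPr_of_pair (D : Set E) (x : E →₀ ZMod 2) (e f : E) (he : e ∈ D) (hf : f ∈ D) (hef : e ≠ f)
    (h : ∀ i ∈ D, i ≠ e → i ≠ f → x i = 0) : glPr D x = x e + x f := by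
  have h1 : glPr D (x - Finsupp.single f (x f)) = x e := by
    rw [glPr_of_single D _ e he]
    · simp [hef.symm]
    · intro i hi hie
      by_cases hif : i = f
      · subst hif; simp
      · simp [h i hi hie hif, Finsupp.single_apply, Ne.symm hif]
  rw [map_sub, glPr_single] at h1
  simp [hf] at h1
  rw [← h1]; ring

lemma glPr_sub (D D' : Set E) (h : D' ⊆ D) : glPr (D \ D') = glPr D - glPr D' := by
  ext i
  simp only [LinearMap.comp_apply, Finsupp.lsingle_apply, LinearMap.sub_apply, glPr_single]
  by_cases h1 : i ∈ D' <;> by_cases h2 : i ∈ D <;> simp [h1, h2]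
  exact absurd (h h1) h2

lemma glPr_congr (D D' : Set E) (x x' : E →₀ ZMod 2)
    (h : ∀ i, x i * D.indicator (1 : E → ZMod 2) i = x' i * D'.indicator (1 : E → ZMod 2) i) :
    glPr D x = glPr D' x' := by
  classical
  rw [glPr_apply, glPr_apply]
  rw [Finset.sum_subset (Finset.subset_union_left (s₂ := x'.support)),
    Finset.sum_subset (Finset.subset_union_right (s₁ := x.support) (s₂ := x'.support))]
  · exact Finset.sum_congr rfl fun i _ => h i
  · intro i _ hi; simp at hi; simp [hi]
  · intro i _ hi; simp at hi; simp [hi]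

lemma zmod2_cases (z : ZMod 2) : z = 0 ∨ z = 1 := by revert z; decide

lemma glPr_functional (L : (E →₀ ZMod 2) →ₗ[ZMod 2] ZMod 2) :
    L = glPr {i | L (Finsupp.single i 1) = 1} := by
  ext i
  simp only [LinearMap.comp_apply, Finsupp.lsingle_apply, glPr_single]
  rcases zmod2_cases (L (Finsupp.single i 1)) with h | h <;> simp [h, Set.indicator]

/-- even sets -/
def glEv (c : P →ₗ[ZMod 2] (E →₀ ZMod 2)) (D : Set E) : Prop := ∀ φ, glPr D (c φ) = 0

/-- circuits: minimal nonempty even sets -/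
def glCirc (c : P →ₗ[ZMod 2] (E →₀ ZMod 2)) (D : Set E) : Prop :=
  glEv c D ∧ D.Nonempty ∧ ∀ D' ⊆ D, glEv c D' → D'.Nonempty → D' = D

lemma glCirc_pair (c : P →ₗ[ZMod 2] (E →₀ ZMod 2)) (D : Set E) (hD : glCirc c D)
    (f g : E) (hf : f ∈ D) (hg : g ∈ D) (hfg : f ≠ g) :
    ∃ φ, c φ f = 1 ∧ c φ g = 1 ∧ ∀ i ∈ D, i ≠ f → i ≠ g → c φ i = 0 := by
  classical
  set t : E →₀ ZMod 2 := Finsupp.single f 1 + Finsupp.single g 1 with ht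
  by_cases hm : t ∈ LinearMap.range c ⊔ Finsupp.supported (ZMod 2) (ZMod 2) Dᶜ
  · obtain ⟨y, ⟨φ, rfl⟩, z, hz, hyz⟩ := Submodule.mem_sup.1 hm
    have key : ∀ i ∈ D, c φ i = t i := by
      intro i hi
      have : z i = 0 := by
        by_contra h0
        exact ((Finsupp.mem_supported _ _).1 hz (by simpa using h0)) hi
      rw [← hyz]; simp [this]
    refine ⟨φ, ?_, ?_, ?_⟩
    · rw [key f hf]; simp [ht, hfg.symm]
    · rw [key g hg]; simp [ht, hfg]
    · intro i hi h1 h2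
      rw [key i hi]; simp [ht, Finsupp.single_apply, Ne.symm h1, Ne.symm h2]
  · obtain ⟨L, hL, hker⟩ := Submodule.exists_le_ker_of_notMem hm
    exfalso
    have hLD := glPr_functional L
    set D' := {i | L (Finsupp.single i 1) = 1} with hD'
    have hsub : D' ⊆ D := by
      intro i hi
      by_contra hiD
      have : L (Finsupp.single i 1) = 0 := by
        apply hker
        apply Submodule.mem_sup_right
        exact Finsupp.single_mem_supported _ _ hiD
      rw [hD', Set.mem_setOf_eq, this] at hi
      exact absurd hi (by decide)
    have hev : glEv c D' := by
      intro φ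
      rw [← hLD]
      exact hker (Submodule.mem_sup_left ⟨φ, rfl⟩)
    apply hL
    rcases D'.eq_empty_or_nonempty with h0 | h0
    · rw [hLD, h0, ht, map_add, glPr_single, glPr_single]; simp
    · have := hD.2.2 D' hsub hev h0
      rw [hLD, this, ht, map_add, glPr_single, glPr_single]; simp [hf, hg]; decide

lemma gl_chain_finset (C : Set (Set E)) (hC : IsChain (· ⊆ ·) C) (hne : C.Nonempty)
    (S : Finset E) : ∃ D ∈ C, ∀ i ∈ S, i ∈ D → i ∈ ⋂₀ C := by
  classical
  induction S using Finset.induction_on with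
  | empty => obtain ⟨D, hD⟩ := hne; exact ⟨D, hD, by simp⟩
  | insert a S _ ih =>
    obtain ⟨D, hD, h⟩ := ih
    by_cases ha : a ∈ ⋂₀ C
    · refine ⟨D, hD, fun i hi hiD => ?_⟩
      rcases Finset.mem_insert.1 hi with rfl | hi
      · exact ha
      · exact h i hi hiD
    · obtain ⟨D2, hD2, haD2⟩ : ∃ D2 ∈ C, a ∉ D2 := by simpa using ha
      rcases hC.total hD hD2 with hs | hs
      · refine ⟨D, hD, fun i hi hiD => ?_⟩
        rcases Finset.mem_insert.1 hi with rfl | hi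
        · exact absurd (hs hiD) haD2
        · exact h i hi hiD
      · refine ⟨D2, hD2, fun i hi hiD => ?_⟩
        rcases Finset.mem_insert.1 hi with rfl | hi
        · exact absurd hiD haD2
        · exact h i hi (hs hiD)

lemma glEv_diff (c : P →ₗ[ZMod 2] (E →₀ ZMod 2)) {D D' : Set E} (h : D' ⊆ D)
    (hD : glEv c D) (hD' : glEv c D') : glEv c (D \ D') := by
  intro φ; rw [glPr_sub D D' h, LinearMap.sub_apply, hD φ, hD' φ, sub_zero]

lemma glCirc_exists (c : P →ₗ[ZMod 2] (E →₀ ZMod 2)) (F : Set E) (hF : glEv c F)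
    (hne : F.Nonempty) : ∃ D ⊆ F, glCirc c D := by
  obtain ⟨e, he⟩ := hne
  obtain ⟨D, hDF, hmin⟩ := zorn_superset_nonempty {D : Set E | glEv c D ∧ e ∈ D} (by
    intro C hCS hC hne
    refine ⟨⋂₀ C, ⟨?_, ?_⟩, fun s hs => Set.sInter_subset_of_mem hs⟩
    · intro φ
      obtain ⟨D, hD, h⟩ := gl_chain_finset C hC hne (c φ).support
      rw [← (hCS hD).1 φ]
      apply glPr_congr
      intro i
      by_cases hi : c φ i = 0
      · simp [hi]
      · congr 1
        by_cases h1 : i ∈ D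
        · rw [Set.indicator_of_mem h1, Set.indicator_of_mem (h i (by simpa using hi) h1)]
        · rw [Set.indicator_of_notMem h1, Set.indicator_of_notMem]
          exact fun h2 => h1 (h2 D hD)
    · exact fun D hD => (hCS hD).2) F ⟨hF, he⟩
  refine ⟨D, hDF, hmin.prop.1, ⟨e, hmin.prop.2⟩, ?_⟩
  intro D' hs hev hne
  by_cases heD : e ∈ D'
  · exact subset_antisymm hs (hmin.le_of_le ⟨hev, heD⟩ hs)
  · have := hmin.le_of_le (y := D \ D') ⟨glEv_diff c hs hmin.prop.1 hev, hmin.prop.2, heD⟩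
      Set.diff_subset
    obtain ⟨x, hx⟩ := hne
    exact absurd hx (this (hs hx)).2

lemma glCirc_decomp (c : P →ₗ[ZMod 2] (E →₀ ZMod 2)) (hu : glEv c Set.univ) :
    ∃ 𝒟 : Set (Set E), (∀ D ∈ 𝒟, glCirc c D) ∧ ∀ i, ∃! D, D ∈ 𝒟 ∧ i ∈ D := by
  classical
  obtain ⟨𝒟, hmax⟩ := zorn_subset {𝒟 : Set (Set E) | (∀ D ∈ 𝒟, glCirc c D) ∧
      ∀ D ∈ 𝒟, ∀ D' ∈ 𝒟, ∀ i, i ∈ D → i ∈ D' → D = D'} (by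
    intro C hCS hC
    refine ⟨⋃₀ C, ⟨?_, ?_⟩, fun s hs => Set.subset_sUnion_of_mem hs⟩
    · rintro D ⟨K, hK, hD⟩
      exact (hCS hK).1 D hD
    · rintro D ⟨K, hK, hD⟩ D' ⟨K', hK', hD'⟩ i hi hi'
      rcases hC.total hK hK' with h | h
      · exact (hCS hK').2 D (h hD) D' hD' i hi hi'
      · exact (hCS hK).2 D hD D' (h hD') i hi hi')
  obtain ⟨h1, h2⟩ := hmax.prop
  refine ⟨𝒟, h1, ?_⟩
  have hU : glEv c (⋃₀ 𝒟) := by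
    intro φ
    let k : E → Set E := fun i => if h : ∃ D ∈ 𝒟, i ∈ D then h.choose else ∅
    have hk : ∀ D ∈ 𝒟, ∀ i ∈ D, k i = D := by
      intro D hD i hi
      have h : ∃ D ∈ 𝒟, i ∈ D := ⟨D, hD, hi⟩
      simp only [k, dif_pos h]
      exact h2 _ h.choose_spec.1 _ hD i h.choose_spec.2 hi
    rw [glPr_apply, ← Finset.sum_fiberwise_of_maps_to (t := (c φ).support.image k) (g := k)
      (fun i hi => Finset.mem_image_of_mem k hi)]
    apply Finset.sum_eq_zero
    intro D _
    by_cases hD : D ∈ 𝒟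
    · rw [← (h1 D hD).1 φ, glPr_apply, Finset.sum_filter]
      apply Finset.sum_congr rfl
      intro i _
      by_cases hi : i ∈ D
      · rw [if_pos (hk D hD i hi), Set.indicator_of_mem hi, Set.indicator_of_mem (s := ⋃₀ 𝒟) ⟨D, hD, hi⟩]
      · rw [Set.indicator_of_notMem hi]
        split_ifs with hki
        · rw [Set.indicator_of_notMem]
          rintro ⟨D', hD', hi'⟩
          rw [hk D' hD' i hi'] at hki
          exact hi (hki ▸ hi')
        · simp
    · apply Finset.sum_eq_zero
      intro i hi
      rw [Set.indicator_of_notMem, mul_zero]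
      rintro ⟨D', hD', hi'⟩
      have := hk D' hD' i hi'
      rw [(Finset.mem_filter.1 hi).2] at this
      exact hD (this ▸ hD')
  have hall : ⋃₀ 𝒟 = Set.univ := by
    by_contra hne
    have hne' : (Set.univ \ ⋃₀ 𝒟).Nonempty := by
      rw [Set.diff_nonempty]
      exact fun h => hne (Set.eq_univ_of_univ_subset h)
    obtain ⟨D, hDs, hD⟩ := glCirc_exists c _ (glEv_diff c (Set.subset_univ _) hu hU) hne'
    have hmem : insert D 𝒟 ⊆ 𝒟 := by
      apply hmax.le_of_ge _ (Set.subset_insert _ _)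
      refine ⟨?_, ?_⟩
      · rintro D' (rfl | h)
        · exact hD
        · exact h1 _ h
      · rintro A (rfl | hA) B (rfl | hB) i hi hi'
        · rfl
        · exact absurd ⟨B, hB, hi'⟩ (hDs hi).2
        · exact absurd ⟨A, hA, hi⟩ (hDs hi').2
        · exact h2 A hA B hB i hi hi'
    obtain ⟨x, hx⟩ := hD.2.1
    exact (hDs hx).2 ⟨D, hmem (Set.mem_insert _ _), hx⟩
  intro i
  obtain ⟨D, hD, hi⟩ : i ∈ ⋃₀ 𝒟 := hall ▸ Set.mem_univ i
  exact ⟨D, ⟨hD, hi⟩, fun D' h => h2 D' h.1 D hD i h.2 hi⟩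

end Alg

section Top

/-- parametrised graph-like structure -/
structure GP (X : Type u) [TopologicalSpace X] (V : Set X) (E : Type) where
  γ : E → ℝ → X
  cont : ∀ i, ContinuousOn (γ i) (Icc 0 1)
  left : ∀ i, γ i 0 ∈ V
  right : ∀ i, γ i 1 ∈ V
  mid : ∀ i, ∀ t ∈ Ioo (0:ℝ) 1, γ i t ∉ V
  cov : ∀ x, x ∉ V → ∃ i, ∃ t ∈ Ioo (0:ℝ) 1, γ i t = x
  inj : ∀ i j t s, t ∈ Ioo (0:ℝ) 1 → s ∈ Ioo (0:ℝ) 1 → γ i t = γ j s → i = j ∧ t = s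
  opn : ∀ i, IsOpen (γ i '' Ioo (0:ℝ) 1)

variable {V : Set X} {E : Type}

lemma continuousOn_image_of_comp [T2Space X] {Z : Type*} [TopologicalSpace Z] {γ : ℝ → X}
    {f : X → Z} {K : Set ℝ} (hK : IsCompact K) (hγ : ContinuousOn γ K)
    (hf : ContinuousOn (fun t => f (γ t)) K) : ContinuousOn f (γ '' K) := by
  rw [continuousOn_iff_isClosed]
  intro t ht
  have h1 : IsClosed (K ∩ (fun t => f (γ t)) ⁻¹' t) := hf.preimage_isClosed_of_isClosed hK.isClosed ht
  have h2 : IsCompact (K ∩ (fun t => f (γ t)) ⁻¹' t) := hK.of_isClosed_subset h1 inter_subset_left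
  refine ⟨γ '' (K ∩ (fun t => f (γ t)) ⁻¹' t), (h2.image_of_continuousOn
    (hγ.mono inter_subset_left)).isClosed, ?_⟩
  ext x
  constructor
  · rintro ⟨hx, s, hs, rfl⟩
    exact ⟨⟨s, ⟨hs, hx⟩, rfl⟩, ⟨s, hs, rfl⟩⟩
  · rintro ⟨⟨s, ⟨hs, hx⟩, rfl⟩, h⟩
    exact ⟨hx, h⟩

namespace GP
variable (Γ : GP X V E)

/-- initial vertex -/
def a (i : E) : V := ⟨Γ.γ i 0, Γ.left i⟩
/-- terminal vertex -/
def b (i : E) : V := ⟨Γ.γ i 1, Γ.right i⟩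

/-- open edge -/
def ed (i : E) : Set X := Γ.γ i '' Ioo (0:ℝ) 1

open Classical in
/-- linear interpolation -/
noncomputable def interp (φ : V → ZMod 2) (x : X) : ℝ :=
  if h : x ∈ V then ((φ ⟨x, h⟩).val : ℝ)
  else
    (1 - (Γ.cov x h).choose_spec.choose) * ((φ (Γ.a (Γ.cov x h).choose)).val : ℝ)
      + (Γ.cov x h).choose_spec.choose * ((φ (Γ.b (Γ.cov x h).choose)).val : ℝ)

lemma interp_V (φ : V → ZMod 2) (x : X) (h : x ∈ V) :
    Γ.interp φ x = ((φ ⟨x, h⟩).val : ℝ) := by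
  simp [interp, h]

lemma interp_V' (φ : V → ZMod 2) (v : V) :
    Γ.interp φ v = ((φ v).val : ℝ) := Γ.interp_V φ v v.2

lemma interp_Ioo (φ : V → ZMod 2) (i : E) (t : ℝ) (ht : t ∈ Ioo (0:ℝ) 1) :
    Γ.interp φ (Γ.γ i t) = (1 - t) * ((φ (Γ.a i)).val : ℝ) + t * ((φ (Γ.b i)).val : ℝ) := by
  have h := Γ.mid i t ht
  have hs := (Γ.cov _ h).choose_spec.choose_spec
  obtain ⟨h1, h2⟩ := Γ.inj _ _ _ _ hs.1 ht hs.2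
  rw [interp, dif_neg h, h2, h1]

lemma interp_Icc (φ : V → ZMod 2) (i : E) (t : ℝ) (ht : t ∈ Icc (0:ℝ) 1) :
    Γ.interp φ (Γ.γ i t) = (1 - t) * ((φ (Γ.a i)).val : ℝ) + t * ((φ (Γ.b i)).val : ℝ) := by
  rcases eq_or_lt_of_le ht.1 with rfl | h0
  · rw [interp_V _ _ _ (Γ.left i)]; simp [a]
  rcases eq_or_lt_of_le ht.2 with rfl | h1
  · rw [interp_V _ _ _ (Γ.right i)]; simp [b]
  exact Γ.interp_Ioo φ i t ⟨h0, h1⟩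

lemma ed_inj {i j : E} {x : X} (hi : x ∈ Γ.ed i) (hj : x ∈ Γ.ed j) : i = j := by
  obtain ⟨t, ht, rfl⟩ := hi
  obtain ⟨s, hs, h⟩ := hj
  exact (Γ.inj _ _ _ _ hs ht h).1.symm

lemma ed_nonempty (i : E) : (Γ.ed i).Nonempty := ⟨_, 1/2, by norm_num, rfl⟩

lemma closure_ed [T2Space X] (i : E) : closure (Γ.ed i) = Γ.γ i '' Icc (0:ℝ) 1 := by
  apply subset_antisymm
  · apply closure_minimal (image_mono Ioo_subset_Icc_self)
    exact (isCompact_Icc.image_of_continuousOn (Γ.cont i)).isClosed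
  · have : Icc (0:ℝ) 1 = closure (Ioo 0 1) := (closure_Ioo (by norm_num)).symm
    rw [this]
    apply ContinuousOn.image_closure
    rw [← this]; exact Γ.cont i

lemma Icc_image_cases (i : E) {x : X} (h : x ∈ Γ.γ i '' Icc (0:ℝ) 1) :
    x ∈ Γ.ed i ∨ x = Γ.a i ∨ x = Γ.b i := by
  obtain ⟨t, ht, rfl⟩ := h
  rcases eq_or_lt_of_le ht.1 with rfl | h0
  · right; left; rfl
  rcases eq_or_lt_of_le ht.2 with rfl | h1
  · right; right; rfl
  exact Or.inl ⟨t, ⟨h0, h1⟩, rfl⟩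

lemma ed_disj_V {i : E} {x : X} (h : x ∈ Γ.ed i) : x ∉ V := by
  obtain ⟨t, ht, rfl⟩ := h
  exact Γ.mid i t ht

lemma key [CompactSpace X] [T2Space X] (hV : IsClosed V) (φ : LocallyConstant V (ZMod 2)) :
    ∃ U0 U1 : Set X, IsOpen U0 ∧ IsOpen U1 ∧ Disjoint U0 U1 ∧ 
      (∀ v : V, φ v = 0 → (v : X) ∈ U0) ∧ (∀ v : V, φ v ≠ 0 → (v : X) ∈ U1) ∧ 
      ∃ T : Finset E, (⋃ i ∈ T, Γ.ed i)ᶜ ⊆ U0 ∪ U1 ∧ 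
        ∀ i ∉ T, (Γ.γ i '' Icc (0:ℝ) 1 ⊆ U0) ∨ (Γ.γ i '' Icc (0:ℝ) 1 ⊆ U1) := by
  have hA : IsClosed (Subtype.val '' (φ ⁻¹' {0})) :=
    hV.isClosedEmbedding_subtypeVal.isClosedMap _ (φ.isLocallyConstant.isClosed_fiber 0)
  have hB : IsClosed (Subtype.val '' (φ ⁻¹' {0}ᶜ)) :=
    hV.isClosedEmbedding_subtypeVal.isClosedMap _ (φ.isLocallyConstant.isClopen_fiber 0).compl.1
  have hd : Disjoint (Subtype.val '' (φ ⁻¹' {0})) (Subtype.val '' (φ ⁻¹' {0}ᶜ)) := by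
    rw [Set.disjoint_left]
    rintro _ ⟨v, hv, rfl⟩ ⟨w, hw, hvw⟩
    rw [Subtype.val_injective hvw] at hw
    exact hw hv
  obtain ⟨U0, U1, hU0, hU1, hA0, hB1, hUU⟩ := normal_separation hA hB hd
  have hv0 : ∀ v : V, φ v = 0 → (v : X) ∈ U0 := fun v hv => hA0 ⟨v, hv, rfl⟩
  have hv1 : ∀ v : V, φ v ≠ 0 → (v : X) ∈ U1 := fun v hv => hB1 ⟨v, hv, rfl⟩
  have hVU : V ⊆ U0 ∪ U1 := by
    intro v hv
    by_cases h : φ ⟨v, hv⟩ = 0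
    · exact Or.inl (hv0 _ h)
    · exact Or.inr (hv1 _ h)
  obtain ⟨T, hT⟩ := (hU0.union hU1).isClosed_compl.isCompact.elim_finite_subcover Γ.ed Γ.opn (by
    intro x hx
    obtain ⟨i, t, ht, h⟩ := Γ.cov x (fun h => hx (hVU h))
    exact mem_iUnion.2 ⟨i, t, ht, h⟩)
  refine ⟨U0, U1, hU0, hU1, hUU, hv0, hv1, T, ?_, ?_⟩
  · rw [compl_subset_comm]; exact hT
  · intro i hi
    have hpre : IsPreconnected (Γ.γ i '' Icc (0:ℝ) 1) := isPreconnected_Icc.image _ (Γ.cont i)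
    have hsub : Γ.γ i '' Icc (0:ℝ) 1 ⊆ U0 ∪ U1 := by
      intro x hx
      rcases Γ.Icc_image_cases i hx with h | h | h
      · by_contra hn
        obtain ⟨j, hj, hxj⟩ := mem_iUnion₂.1 (hT hn)
        rw [Γ.ed_inj h hxj] at hi
        exact hi hj
      · rw [h]; exact hVU (Γ.a i).2
      · rw [h]; exact hVU (Γ.b i).2
    exact hpre.subset_or_subset hU0 hU1 hUU hsub

lemma interp_continuous [CompactSpace X] [T2Space X] (hV : IsClosed V)
    (φ : LocallyConstant V (ZMod 2)) : Continuous (Γ.interp φ) := by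
  obtain ⟨U0, U1, hU0, hU1, hUU, hv0, hv1, T, hT, hTe⟩ := Γ.key hV φ
  have e0 : ∀ v : V, (v : X) ∈ U0 → φ v = 0 := fun v hv => by
    by_contra h; exact Set.disjoint_left.1 hUU hv (hv1 v h)
  have e1 : ∀ v : V, (v : X) ∈ U1 → φ v = 1 := fun v hv => by
    rcases zmod2_cases (φ v) with h | h
    · exact absurd hv (Set.disjoint_left.1 hUU (hv0 v h))
    · exact h
  have g0 : ∀ x ∈ (⋃ i ∈ T, Γ.ed i)ᶜ, ∀ z : ZMod 2, ∀ U U' : Set X, Disjoint U U' → 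
      (∀ v : V, (v : X) ∈ U → φ v = z) → 
      (∀ i ∉ T, (Γ.γ i '' Icc (0:ℝ) 1 ⊆ U) ∨ (Γ.γ i '' Icc (0:ℝ) 1 ⊆ U')) →
      x ∈ U → Γ.interp φ x = z.val := by
    intro x hx z U U' hd hz he hxU
    by_cases hxV : x ∈ V
    · rw [Γ.interp_V φ x hxV, hz _ hxU]
    · obtain ⟨i, t, ht, rfl⟩ := Γ.cov x hxV
      have hi : i ∉ T := fun hi => hx (mem_iUnion₂.2 ⟨i, hi, t, ht, rfl⟩)
      rcases he i hi with h | h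
      · rw [Γ.interp_Ioo φ i t ht, hz (Γ.a i) (h ⟨0, by norm_num, rfl⟩),
          hz (Γ.b i) (h ⟨1, by norm_num, rfl⟩)]
        ring
      · exact absurd (h ⟨t, Ioo_subset_Icc_self ht, rfl⟩) (Set.disjoint_left.1 hd hxU)
  have c0 : ContinuousOn (Γ.interp φ) (⋃ i ∈ T, Γ.ed i)ᶜ := by
    intro x hx
    have main : ∀ z : ZMod 2, ∀ U U' : Set X, IsOpen U → Disjoint U U' → 
      (∀ v : V, (v : X) ∈ U → φ v = z) → 
      (∀ i ∉ T, (Γ.γ i '' Icc (0:ℝ) 1 ⊆ U) ∨ (Γ.γ i '' Icc (0:ℝ) 1 ⊆ U')) →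
      x ∈ U → ContinuousWithinAt (Γ.interp φ) (⋃ i ∈ T, Γ.ed i)ᶜ x := by
      intro z U U' hUo hd hz he hxU
      apply (continuousWithinAt_const (b := (z.val : ℝ))).congr_of_eventuallyEq
      · filter_upwards [self_mem_nhdsWithin, mem_nhdsWithin_of_mem_nhds (hUo.mem_nhds hxU)] with y h1 h2
        exact g0 y h1 z U U' hd hz he h2
      · exact g0 x hx z U U' hd hz he hxU
    rcases hT hx with h | h
    · exact main 0 U0 U1 hU0 hUU e0 hTe h
    · exact main 1 U1 U0 hU1 hUU.symm e1 (fun i hi => (hTe i hi).symm) h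
  have c1 : ∀ i, ContinuousOn (Γ.interp φ) (Γ.γ i '' Icc (0:ℝ) 1) := by
    intro i
    apply continuousOn_image_of_comp isCompact_Icc (Γ.cont i)
    apply ContinuousOn.congr (f := fun t : ℝ => (1 - t) * ((φ (Γ.a i)).val : ℝ) + t * ((φ (Γ.b i)).val : ℝ))
    · fun_prop
    · intro t ht
      exact Γ.interp_Icc φ i t ht
  have c2 : ∀ S : Finset E, ContinuousOn (Γ.interp φ) (⋃ i ∈ S, Γ.γ i '' Icc (0:ℝ) 1) ∧
      IsClosed (⋃ i ∈ S, Γ.γ i '' Icc (0:ℝ) 1) := by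
    classical
    intro S
    induction S using Finset.induction_on with
    | empty => simp
    | insert j S _ ih =>
      have hc : IsClosed (Γ.γ j '' Icc (0:ℝ) 1) := 
        (isCompact_Icc.image_of_continuousOn (Γ.cont j)).isClosed
      rw [Finset.set_biUnion_insert]
      exact ⟨(c1 j).union_of_isClosed ih.1 hc ih.2, hc.union ih.2⟩
  rw [← continuousOn_univ]
  have : (univ : Set X) = (⋃ i ∈ T, Γ.ed i)ᶜ ∪ (⋃ i ∈ T, Γ.γ i '' Icc (0:ℝ) 1) := by
    symm
    rw [eq_univ_iff_forall]
    intro x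
    by_cases h : x ∈ (⋃ i ∈ T, Γ.ed i)
    · right
      obtain ⟨i, hi, hx⟩ := mem_iUnion₂.1 h
      exact mem_iUnion₂.2 ⟨i, hi, image_mono Ioo_subset_Icc_self hx⟩
    · exact Or.inl h
  rw [this]
  apply c0.union_of_isClosed (c2 T).1 _ (c2 T).2
  exact (isOpen_biUnion fun i _ => Γ.opn i).isClosed_compl

lemma finite_cut [CompactSpace X] [T2Space X] (hV : IsClosed V)
    (φ : LocallyConstant V (ZMod 2)) : (Function.support fun i => φ (Γ.a i) + φ (Γ.b i)).Finite := by
  obtain ⟨U0, U1, hU0, hU1, hUU, hv0, hv1, T, hT, hTe⟩ := Γ.key hV φ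
  apply T.finite_toSet.subset
  intro i hi
  by_contra hiT
  apply hi
  have e0 : ∀ v : V, (v : X) ∈ U0 → φ v = 0 := fun v hv => by
    by_contra h; exact Set.disjoint_left.1 hUU hv (hv1 v h)
  have e1 : ∀ v : V, (v : X) ∈ U1 → φ v = 1 := fun v hv => by
    rcases zmod2_cases (φ v) with h | h
    · exact absurd hv (Set.disjoint_left.1 hUU (hv0 v h))
    · exact h
  rcases hTe i hiT with h | h
  · simp only [e0 (Γ.a i) (h ⟨0, by norm_num, rfl⟩), e0 (Γ.b i) (h ⟨1, by norm_num, rfl⟩)]; decide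
  · simp only [e1 (Γ.a i) (h ⟨0, by norm_num, rfl⟩), e1 (Γ.b i) (h ⟨1, by norm_num, rfl⟩)]; decide

/-- the coboundary map -/
noncomputable def cob [CompactSpace X] [T2Space X] (hV : IsClosed V) :
    LocallyConstant V (ZMod 2) →ₗ[ZMod 2] (E →₀ ZMod 2) where
  toFun φ := Finsupp.ofSupportFinite (fun i => φ (Γ.a i) + φ (Γ.b i)) (Γ.finite_cut hV φ)
  map_add' φ ψ := by
    ext i
    change (φ (Γ.a i) + ψ (Γ.a i)) + (φ (Γ.b i) + ψ (Γ.b i)) =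
      (φ (Γ.a i) + φ (Γ.b i)) + (ψ (Γ.a i) + ψ (Γ.b i))
    ring
  map_smul' r φ := by
    ext i
    change r * φ (Γ.a i) + r * φ (Γ.b i) = r * (φ (Γ.a i) + φ (Γ.b i))
    ring

lemma cob_apply [CompactSpace X] [T2Space X] (hV : IsClosed V) (φ : LocallyConstant V (ZMod 2))
    (i : E) : Γ.cob hV φ i = φ (Γ.a i) + φ (Γ.b i) := rfl

end GP

end Top

section Core
namespace GP
variable {V : Set X} {E : Type} (Γ : GP X V E)

/-- closure of a set of edges -/
def Y (D : Set E) : Set X := closure (⋃ i ∈ D, Γ.ed i)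

lemma Y_cases {D : Set E} {x : X} (hx : x ∈ Γ.Y D) : x ∈ V ∨ ∃ i ∈ D, x ∈ Γ.ed i := by
  by_contra h
  push Not at h
  obtain ⟨i, t, ht, rfl⟩ := Γ.cov x h.1
  obtain ⟨y, hy, hyD⟩ := mem_closure_iff.1 hx (Γ.ed i) (Γ.opn i) ⟨t, ht, rfl⟩
  obtain ⟨j, hj, hyj⟩ := mem_iUnion₂.1 hyD
  have := Γ.ed_inj hy hyj
  subst this
  exact h.2 i hj ⟨t, ht, rfl⟩

lemma Y_ed {D : Set E} {i : E} (hi : i ∈ D) : Γ.ed i ⊆ Γ.Y D :=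
  (subset_biUnion_of_mem hi).trans subset_closure

lemma Y_Icc [T2Space X] {D : Set E} {i : E} (hi : i ∈ D) : Γ.γ i '' Icc (0:ℝ) 1 ⊆ Γ.Y D := by
  rw [← Γ.closure_ed i]
  exact closure_mono (subset_biUnion_of_mem hi)

lemma Y_a [T2Space X] {D : Set E} {i : E} (hi : i ∈ D) : (Γ.a i : X) ∈ Γ.Y D :=
  Γ.Y_Icc hi ⟨0, by norm_num, rfl⟩

lemma Y_b [T2Space X] {D : Set E} {i : E} (hi : i ∈ D) : (Γ.b i : X) ∈ Γ.Y D :=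
  Γ.Y_Icc hi ⟨1, by norm_num, rfl⟩

lemma zmod2_add_eq_zero {x y : ZMod 2} : x + y = 0 ↔ x = y := by revert x y; decide

lemma zmod2_add_eq_one {x y : ZMod 2} : x + y = 1 ↔ x ≠ y := by revert x y; decide

lemma circ_const [CompactSpace X] [T2Space X] (hV : IsClosed V) {D : Set E}
    (hD : glCirc (Γ.cob hV) D) (φ : LocallyConstant V (ZMod 2))
    (h : ∀ i ∈ D, φ (Γ.a i) = φ (Γ.b i)) : ∃ κ, ∀ v : V, (v : X) ∈ Γ.Y D → φ v = κ := by
  have main : ∀ κ : ZMod 2, (∀ i ∈ D, φ (Γ.a i) = κ) → ∀ v : V, (v : X) ∈ Γ.Y D → φ v = κ := by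
    intro κ hκ v hv
    have hcl : IsClosed {x | Γ.interp φ x = κ.val} :=
      isClosed_eq (Γ.interp_continuous hV φ) continuous_const
    have hsub : (⋃ i ∈ D, Γ.ed i) ⊆ {x | Γ.interp φ x = κ.val} := by
      intro x hx
      obtain ⟨i, hi, t, ht, rfl⟩ := mem_iUnion₂.1 hx
      show Γ.interp φ _ = _
      rw [Γ.interp_Ioo _ _ _ ht, ← h i hi, hκ i hi]; ring
    have := closure_minimal hsub hcl hv
    have h2 : Γ.interp φ v = κ.val := this
    rw [Γ.interp_V' φ v] at h2
    exact ZMod.val_injective 2 (by exact_mod_cast h2)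
  have hev : glEv (Γ.cob hV) {i ∈ D | φ (Γ.a i) = 1} := by
    intro χ
    rw [← hD.1 (χ * φ)]
    apply glPr_congr
    intro i
    rw [cob_apply, cob_apply]
    by_cases hi : i ∈ D
    · simp only [LocallyConstant.mul_apply, ← h i hi]
      rcases zmod2_cases (φ (Γ.a i)) with h1 | h1 <;> simp [Set.indicator, hi, h1]
    · simp [Set.indicator, hi]
  rcases Set.eq_empty_or_nonempty {i ∈ D | φ (Γ.a i) = 1} with h0 | h0
  · refine ⟨0, main 0 fun i hi => ?_⟩
    rcases zmod2_cases (φ (Γ.a i)) with h1 | h1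
    · exact h1
    · have : i ∈ {i ∈ D | φ (Γ.a i) = 1} := ⟨hi, h1⟩
      rw [h0] at this; exact absurd this (by simp)
  · refine ⟨1, main 1 fun i hi => ?_⟩
    have h3 := hD.2.2 _ (fun i hi => hi.1) hev h0
    rw [← h3] at hi
    exact hi.2

lemma sep [CompactSpace X] [T2Space X] (hV : IsClosed V) [TotallyDisconnectedSpace V]
    (A B : Set X) (hA : IsClosed A) (hB : IsClosed B) (hAB : Disjoint A B) :
    ∃ χ : LocallyConstant V (ZMod 2), (∀ v : V, (v : X) ∈ A → χ v = 1) ∧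
      (∀ v : V, (v : X) ∈ B → χ v = 0) := by
  haveI : CompactSpace V := isCompact_iff_compactSpace.1 hV.isCompact
  obtain ⟨C, hC, hAC, hCB⟩ := exists_clopen_of_closed_subset_open (X := V)
    (hA.preimage continuous_subtype_val) (hB.preimage continuous_subtype_val).isOpen_compl
    (fun v hv hvB => Set.disjoint_left.1 hAB hv hvB)
  refine ⟨LocallyConstant.charFn (ZMod 2) hC, ?_, ?_⟩
  · intro v hv
    rw [LocallyConstant.charFn_eq_one]; exact hAC hv
  · intro v hv
    rw [LocallyConstant.charFn_eq_zero]; exact fun h => hCB h hv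

lemma interp_mem (φ : V → ZMod 2) (x : X) : 0 ≤ Γ.interp φ x ∧ Γ.interp φ x ≤ 1 := by
  have hv : ∀ z : ZMod 2, (0:ℝ) ≤ z.val ∧ (z.val : ℝ) ≤ 1 := by
    intro z; rcases zmod2_cases z with rfl | rfl <;> simp [ZMod.val_one]
  by_cases h : x ∈ V
  · rw [Γ.interp_V φ x h]; exact hv _
  · obtain ⟨i, t, ht, rfl⟩ := Γ.cov x h
    rw [Γ.interp_Ioo φ i t ht]
    have h1 := hv (φ (Γ.a i)); have h2 := hv (φ (Γ.b i)); obtain ⟨h3, h4⟩ := ht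
    constructor
    · have : 0 ≤ 1 - t := by linarith
      have := mul_nonneg this h1.1
      have := mul_nonneg h3.le h2.1
      linarith
    · nlinarith

/-- cut functions along a circuit -/
structure Fam (Γ : GP X V E) (D : Set E) (e : E) (J : Type) (ι : J → E) where
  φ : J → LocallyConstant V (ZMod 2)
  mem : ∀ j, ι j ∈ D
  ne : ∀ j, ι j ≠ e
  surj : ∀ i ∈ D, i ≠ e → ∃ j, ι j = i
  inj : Function.Injective ι
  be : ∀ j, φ j (Γ.b e) = 0
  ae : ∀ j, φ j (Γ.a e) = 1
  cr : ∀ j, φ j (Γ.a (ι j)) ≠ φ j (Γ.b (ι j))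
  nc : ∀ j, ∀ i ∈ D, i ≠ e → i ≠ ι j → φ j (Γ.a i) = φ j (Γ.b i)

lemma fam_exists [CompactSpace X] [T2Space X] (hV : IsClosed V) {D : Set E}
    (hD : glCirc (Γ.cob hV) D) (e : E) (he : e ∈ D) :
    Nonempty (Fam Γ D e {i // i ∈ D ∧ i ≠ e} Subtype.val) := by
  have : ∀ j : {i // i ∈ D ∧ i ≠ e}, ∃ φ : LocallyConstant V (ZMod 2), φ (Γ.b e) = 0 ∧ 
      φ (Γ.a e) = 1 ∧ φ (Γ.a j) ≠ φ (Γ.b j) ∧ 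
      ∀ i ∈ D, i ≠ e → i ≠ j → φ (Γ.a i) = φ (Γ.b i) := by
    rintro ⟨j, hj, hje⟩
    obtain ⟨φ, h1, h2, h3⟩ := glCirc_pair _ D hD e j he hj hje.symm
    simp only [cob_apply, zmod2_add_eq_zero, zmod2_add_eq_one] at h1 h2 h3
    rcases zmod2_cases (φ (Γ.b e)) with h0 | h0
    · refine ⟨φ, h0, ?_, h2, h3⟩
      rw [h0] at h1
      exact (zmod2_cases _).resolve_left h1
    · refine ⟨φ + 1, ?_, ?_, ?_, ?_⟩
      · simp [h0]; decide
      · rw [h0] at h1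
        simp [(zmod2_cases _).resolve_right h1]
      · simpa using h2
      · simpa using h3
  choose φ h1 h2 h3 h4 using this
  exact ⟨⟨φ, fun j => j.2.1, fun j => j.2.2, fun i hi hie => ⟨⟨i, hi, hie⟩, rfl⟩,
    Subtype.val_injective, h1, h2, h3, h4⟩⟩

variable {Γ} {D : Set E} {e : E} {J : Type} {ι : J → E}

namespace Fam
variable (F : Fam Γ D e J ι)

/-- real coordinate -/
noncomputable def ψ (j : J) : X → ℝ := Γ.interp (F.φ j)

lemma ψ_mem (j : J) (x : X) : 0 ≤ F.ψ j x ∧ F.ψ j x ≤ 1 := Γ.interp_mem _ x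

lemma F1 (j : J) (x : X) (hx : x ∈ Γ.Y D) (hxe : x ∉ Γ.ed e) (hxj : x ∉ Γ.ed (ι j)) :
    F.ψ j x = 0 ∨ F.ψ j x = 1 := by
  have hv : ∀ z : ZMod 2, (z.val : ℝ) = 0 ∨ (z.val : ℝ) = 1 := by
    intro z; rcases zmod2_cases z with rfl | rfl <;> simp [ZMod.val_one]
  rcases Γ.Y_cases hx with h | ⟨i, hi, h⟩
  · rw [ψ, Γ.interp_V _ x h]; exact hv _
  · have h1 : i ≠ e := by rintro rfl; exact hxe h
    have h2 : i ≠ ι j := by rintro rfl; exact hxj h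
    obtain ⟨t, ht, rfl⟩ := h
    rw [ψ, Γ.interp_Ioo _ i t ht, ← F.nc j i hi h1 h2]
    have := hv (F.φ j (Γ.a i))
    convert this using 2 <;> ring

lemma F2 (j : J) (t : ℝ) (ht : t ∈ Ioo (0:ℝ) 1) : 
    F.ψ j (Γ.γ (ι j) t) = t ∧ F.φ j (Γ.a (ι j)) = 0 ∨ 
    F.ψ j (Γ.γ (ι j) t) = 1 - t ∧ F.φ j (Γ.a (ι j)) = 1 := by
  have h := F.cr j
  rw [ψ, Γ.interp_Ioo _ _ t ht]
  rcases zmod2_cases (F.φ j (Γ.a (ι j))) with h1 | h1 <;>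
  rcases zmod2_cases (F.φ j (Γ.b (ι j))) with h2 | h2 <;> rw [h1, h2] at h ⊢ <;>
    simp [ZMod.val_one] at h ⊢

lemma F3 [CompactSpace X] [T2Space X] (hV : IsClosed V)
    (hD : glCirc (Γ.cob hV) D) (he : e ∈ D) (j k : J) (hjk : j ≠ k) : 
    (∀ x ∈ Γ.Y D, F.ψ j x ≤ F.ψ k x) ∨ (∀ x ∈ Γ.Y D, F.ψ k x ≤ F.ψ j x) := by
  have main : ∀ j k, (∀ i ∈ D, (F.φ j * F.φ k + F.φ j) (Γ.a i) = (F.φ j * F.φ k + F.φ j) (Γ.b i)) → 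
      ∀ x ∈ Γ.Y D, F.ψ j x ≤ F.ψ k x := by
    intro j k h x hx
    obtain ⟨κ, hκ⟩ := Γ.circ_const hV hD _ h
    have h0 := hκ (Γ.b e) (Γ.Y_b he)
    simp [F.be] at h0
    subst h0
    have hle : ∀ v : V, (v : X) ∈ Γ.Y D → ((F.φ j v).val : ℝ) ≤ (F.φ k v).val := by
      intro v hv
      have := hκ v hv
      simp only [LocallyConstant.add_apply, LocallyConstant.mul_apply] at this
      rcases zmod2_cases (F.φ j v) with h1 | h1 <;> rcases zmod2_cases (F.φ k v) with h2 | h2 <;>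
        rw [h1, h2] at this ⊢ <;> first | (exfalso; revert this; decide) | simp [ZMod.val_one]
    rcases Γ.Y_cases hx with h | ⟨i, hi, t, ht, rfl⟩
    · rw [ψ, ψ, Γ.interp_V _ x h, Γ.interp_V _ x h]; exact hle _ hx
    · rw [ψ, ψ, Γ.interp_Ioo _ i t ht, Γ.interp_Ioo _ i t ht]
      have h1 := hle _ (Γ.Y_a hi)
      have h2 := hle _ (Γ.Y_b hi)
      have h3 : 0 ≤ 1 - t := by linarith [ht.2]
      have := mul_le_mul_of_nonneg_left h1 h3
      have := mul_le_mul_of_nonneg_left h2 ht.1.le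
      linarith
  have hne : ι j ≠ ι k := fun h => hjk (F.inj h)
  -- parity
  have hpar := hD.1 (F.φ j * F.φ k)
  have hother : ∀ i ∈ D, i ≠ e → i ≠ ι j → i ≠ ι k →
      (F.φ j * F.φ k) (Γ.a i) = (F.φ j * F.φ k) (Γ.b i) := by
    intro i hi h1 h2 h3
    simp [F.nc j i hi h1 h2, F.nc k i hi h1 h3]
  have hae : (F.φ j * F.φ k) (Γ.a e) = 1 := by simp [F.ae]
  have hbe : (F.φ j * F.φ k) (Γ.b e) = 0 := by simp [F.be]
  have fin : ∀ j k, j ≠ k → (F.φ j * F.φ k) (Γ.a (ι k)) = (F.φ j * F.φ k) (Γ.b (ι k)) →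
      (F.φ j * F.φ k) (Γ.a (ι j)) ≠ (F.φ j * F.φ k) (Γ.b (ι j)) →
      ∀ x ∈ Γ.Y D, F.ψ j x ≤ F.ψ k x := by
    intro j k hjk h1 h2
    have hne : ι j ≠ ι k := fun h => hjk (F.inj h)
    apply main j k
    intro i hi
    by_cases hie : i = e
    · subst hie; simp [F.be, F.ae]; decide
    by_cases hij : i = ι j
    · subst hij
      have h3 := F.cr j
      simp only [LocallyConstant.add_apply]
      generalize (F.φ j * F.φ k) (Γ.a (ι j)) = p at *
      generalize (F.φ j * F.φ k) (Γ.b (ι j)) = q at *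
      generalize (F.φ j) (Γ.a (ι j)) = r at *
      generalize (F.φ j) (Γ.b (ι j)) = s at *
      clear main hother
      revert p q r s; decide
    by_cases hik : i = ι k
    · subst hik
      simp only [LocallyConstant.add_apply]
      rw [h1, F.nc j _ (F.mem k) (F.ne k) hij]
    · simp [F.nc j i hi hie hij, F.nc k i hi hie hik]
  by_cases hk : (F.φ j * F.φ k) (Γ.a (ι k)) = (F.φ j * F.φ k) (Γ.b (ι k))
  · left
    apply fin j k hjk hk
    intro hj
    rw [glPr_of_single D _ e he, cob_apply, hae, hbe] at hpar
    · exact absurd hpar (by decide)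
    · intro i hi hie
      rw [cob_apply, zmod2_add_eq_zero]
      by_cases h1 : i = ι j
      · rw [h1]; exact hj
      by_cases h2 : i = ι k
      · rw [h2]; exact hk
      exact hother i hi hie h1 h2
  · right
    rw [mul_comm] at hk
    refine fin k j hjk.symm ?_ hk
    by_contra hj
    rw [mul_comm] at hj
    rw [mul_comm] at hk
    -- three odd edges
    have h3 : glPr D (Γ.cob hV (F.φ j * F.φ k) - Finsupp.single e 1) = 
        1 + 1 := by
      rw [glPr_of_pair D _ (ι j) (ι k) (F.mem j) (F.mem k) hne]
      · have hj' := zmod2_add_eq_one.2 hj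
        have hk' := zmod2_add_eq_one.2 hk
        rw [← cob_apply (hV := hV)] at hj' hk'
        simp [hj', hk', F.ne j, F.ne k]
      · intro i hi h1 h2
        by_cases hie : i = e
        · subst hie
          rw [Finsupp.sub_apply, cob_apply, hae, hbe]; simp
        · rw [Finsupp.sub_apply, cob_apply, zmod2_add_eq_zero.2 (hother i hi hie h1 h2)]
          simp [Finsupp.single_apply, Ne.symm hie]
    rw [map_sub, hpar, glPr_single, Set.indicator_of_mem he, Pi.one_apply] at h3
    exact absurd h3 (by decide)

lemma F4 [CompactSpace X] [T2Space X] (hV : IsClosed V) [TotallyDisconnectedSpace V]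
    (hD : glCirc (Γ.cob hV) D) (he : e ∈ D) (x y : X) (hx : x ∈ Γ.Y D) (hxe : x ∉ Γ.ed e)
    (hy : y ∈ Γ.Y D) (hye : y ∉ Γ.ed e) (h : ∀ j, F.ψ j x = F.ψ j y) : x = y := by
  have edge : ∀ x y : X, y ∈ Γ.Y D → y ∉ Γ.ed e → (∀ j, F.ψ j x = F.ψ j y) → ∀ i ∈ D, x ∈ Γ.ed i → 
      x ∉ Γ.ed e → x = y := by
    intro x y hy hye h i hi hxi hxe
    obtain ⟨j, rfl⟩ := F.surj i hi (by rintro rfl; exact hxe hxi)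
    obtain ⟨t, ht, rfl⟩ := hxi
    have hj := h j
    have ht' := ht
    obtain ⟨h0, h1⟩ := ht'
    by_cases hyj : y ∈ Γ.ed (ι j)
    · obtain ⟨s, hs, rfl⟩ := hyj
      have : t = s := by
        rcases F.F2 j t ht with ⟨h2, h3⟩ | ⟨h2, h3⟩ <;> rcases F.F2 j s hs with ⟨h4, h5⟩ | ⟨h4, h5⟩
        · linarith
        · rw [h3] at h5; exact absurd h5 (by decide)
        · rw [h3] at h5; exact absurd h5 (by decide)
        · linarith
      rw [this]
    · exfalso
      rcases F.F2 j t ht with ⟨h2, h3⟩ | ⟨h2, h3⟩ <;> rcases F.F1 j y hy hye hyj with h4 | h4 <;>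
        linarith
  rcases Γ.Y_cases hx with hxV | ⟨i, hi, hxi⟩
  swap
  · exact edge x y hy hye h i hi hxi hxe
  rcases Γ.Y_cases hy with hyV | ⟨i, hi, hyi⟩
  swap
  · exact (edge y x hx hxe (fun j => (h j).symm) i hi hyi hye).symm
  by_contra hxy
  obtain ⟨χ, hχ1, hχ0⟩ := sep hV {x} {y} isClosed_singleton isClosed_singleton (by simpa using hxy)
  have hcx := hχ1 ⟨x, hxV⟩ rfl
  have hcy := hχ0 ⟨y, hyV⟩ rfl
  classical
  let S : Finset J := (Γ.cob hV χ).support.preimage ι F.inj.injOn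
  set χ' := χ + ∑ j ∈ S, F.φ j with hχ'
  have hap : ∀ v, χ' v = χ v + ∑ j ∈ S, F.φ j v := by
    intro v
    have : ∀ T : Finset J, (∑ j ∈ T, F.φ j) v = ∑ j ∈ T, F.φ j v := by
      intro T
      induction T using Finset.induction_on with
      | empty => simp
      | insert a T ha ih => rw [Finset.sum_insert ha, Finset.sum_insert ha, ← ih]; rfl
    rw [hχ', ← this]; rfl
  have hoff : ∀ i ∈ D, i ≠ e → χ' (Γ.a i) = χ' (Γ.b i) := by
    intro i hi hie
    obtain ⟨j, rfl⟩ := F.surj i hi hie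
    rw [hap, hap]
    have hrest : ∀ k ∈ S, k ≠ j → F.φ k (Γ.a (ι j)) = F.φ k (Γ.b (ι j)) := by
      intro k _ hk
      exact F.nc k _ (F.mem j) (F.ne j) (fun h => hk (F.inj h).symm)
    by_cases hj : j ∈ S
    · rw [← Finset.add_sum_erase S _ hj, ← Finset.add_sum_erase S (fun j_1 => F.φ j_1 (Γ.b (ι j))) hj]
      rw [Finset.sum_congr rfl (fun k hk => hrest k (Finset.mem_of_mem_erase hk) (Finset.ne_of_mem_erase hk))]
      have h1 : Γ.cob hV χ (ι j) ≠ 0 := by simpa [S] using hj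
      rw [cob_apply] at h1
      have h2 := F.cr j
      generalize ∑ k ∈ S.erase j, F.φ k (Γ.b (ι j)) = m at *
      generalize χ (Γ.a (ι j)) = p at *
      generalize χ (Γ.b (ι j)) = q at *
      generalize F.φ j (Γ.a (ι j)) = r at *
      generalize F.φ j (Γ.b (ι j)) = s at *
      clear hap hrest hcx hcy hχ1 hχ0 edge
      revert m p q r s; decide
    · have h1 : Γ.cob hV χ (ι j) = 0 := by simpa [S] using hj
      rw [cob_apply, zmod2_add_eq_zero] at h1
      rw [h1, Finset.sum_congr rfl (fun k hk => hrest k hk (by rintro rfl; exact hj hk))]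
  have hone : χ' (Γ.a e) = χ' (Γ.b e) := by
    have := hD.1 χ'
    rw [glPr_of_single D _ e he (fun i hi hie => by
      rw [cob_apply, zmod2_add_eq_zero]; exact hoff i hi hie), cob_apply, zmod2_add_eq_zero] at this
    exact this
  obtain ⟨κ, hκ⟩ := Γ.circ_const hV hD χ' (fun i hi => by
    by_cases hie : i = e
    · rw [hie]; exact hone
    · exact hoff i hi hie)
  have hx' := hκ ⟨x, hxV⟩ hx
  have hy' := hκ ⟨y, hyV⟩ hy
  rw [hap, hcx] at hx'
  rw [hap, hcy] at hy'
  have heq : ∀ j, F.φ j ⟨x, hxV⟩ = F.φ j ⟨y, hyV⟩ := by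
    intro j
    have := h j
    rw [ψ, Γ.interp_V _ x hxV, Γ.interp_V _ y hyV] at this
    exact ZMod.val_injective 2 (by exact_mod_cast this)
  simp only [heq] at hx'
  rw [← hy'] at hx'
  simp at hx'

end Fam
end GP
end Core

section Homeo
namespace GP
variable {V : Set X} {E : Type} (Γ : GP X V E)

lemma circle_exp_inj (r s : ℝ) (h : Circle.exp (2 * Real.pi * r) = Circle.exp (2 * Real.pi * s))
    (h1 : r - s < 1) (h2 : s - r < 1) : r = s := by
  obtain ⟨m, hm⟩ := Circle.exp_eq_exp.1 h
  have hpi := Real.pi_pos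
  have : r - s = m := by
    have h3 : (2 * Real.pi) * (r - s - m) = 0 := by linarith
    rcases mul_eq_zero.1 h3 with h4 | h4
    · linarith
    · linarith
  have h5 : (m : ℝ) < 1 := by linarith
  have h6 : (-1 : ℝ) < m := by linarith
  have h7 : m < 1 := by exact_mod_cast h5
  have h8 : -1 < m := by exact_mod_cast h6
  have : m = 0 := by omega
  subst this
  simp at *; linarith

lemma circle_exp_surj (z : Circle) : ∃ r : ℝ, 0 < r ∧ r ≤ 1 ∧ Circle.exp (2 * Real.pi * r) = z := by
  have hpi := Real.pi_pos
  set r0 := Complex.arg z / (2 * Real.pi) with hr0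
  refine ⟨r0 - ⌈r0⌉ + 1, by linarith [Int.ceil_lt_add_one r0], by linarith [Int.le_ceil r0], ?_⟩
  rw [← Circle.exp_arg z, Circle.exp_eq_exp]
  refine ⟨1 - ⌈r0⌉, ?_⟩
  have : Complex.arg z = 2 * Real.pi * r0 := by rw [hr0]; field_simp
  rw [this]; push_cast; ring

theorem circuit_circle [CompactSpace X] [T2Space X] (hV : IsClosed V) [TotallyDisconnectedSpace V]
    [Countable E] {D : Set E} (hD : glCirc (Γ.cob hV) D) : Nonempty (Γ.Y D ≃ₜ Circle) := by
  classical
  obtain ⟨e, he⟩ := hD.2.1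
  obtain ⟨F⟩ := Γ.fam_exists hV hD e he
  set J := {i // i ∈ D ∧ i ≠ e} with hJ
  haveI : Encodable J := Encodable.ofCountable J
  obtain ⟨w, hw, c, hwc, hc⟩ := posSumOfEncodable (ε := 1/2) (by norm_num) J
  have hc0 : 0 ≤ c := hwc.nonneg fun j => (hw j).le
  have hsum : ∀ x, Summable fun j => w j * F.ψ j x := fun x =>
    Summable.of_nonneg_of_le (fun j => mul_nonneg (hw j).le (F.ψ_mem j x).1)
      (fun j => mul_le_of_le_one_right (hw j).le (F.ψ_mem j x).2) hwc.summable
  set Φ : X → ℝ := fun x => (1 - c) + ∑' j, w j * F.ψ j x with hΦ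
  have hΦc : Continuous Φ := by
    refine continuous_const.add (continuous_tsum (u := w) ?_ hwc.summable ?_)
    · intro j; exact continuous_const.mul (Γ.interp_continuous hV (F.φ j))
    · intro j x
      rw [Real.norm_of_nonneg (mul_nonneg (hw j).le (F.ψ_mem j x).1)]
      exact mul_le_of_le_one_right (hw j).le (F.ψ_mem j x).2
  have hΦ0 : ∀ x, 1 - c ≤ Φ x := fun x => by
    have : 0 ≤ ∑' j, w j * F.ψ j x := tsum_nonneg fun j => mul_nonneg (hw j).le (F.ψ_mem j x).1
    simp only [hΦ]; linarith
  have hΦ1 : ∀ x, Φ x ≤ 1 := fun x => by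
    have : ∑' j, w j * F.ψ j x ≤ ∑' j, w j := (hsum x).tsum_le_tsum
      (fun j => mul_le_of_le_one_right (hw j).le (F.ψ_mem j x).2) hwc.summable
    rw [hwc.tsum_eq] at this
    simp only [hΦ]; linarith
  have hψb : ∀ j, F.ψ j (Γ.b e) = 0 := fun j => by
    rw [Fam.ψ, Γ.interp_V', F.be]; simp
  have hψa : ∀ j, F.ψ j (Γ.a e) = 1 := fun j => by
    rw [Fam.ψ, Γ.interp_V', F.ae]; simp [ZMod.val_one]
  have hΦb : Φ (Γ.b e) = 1 - c := by simp [hΦ, hψb]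
  have hΦa : Φ (Γ.a e) = 1 := by simp [hΦ, hψa, hwc.tsum_eq]
  -- injectivity of Φ off e
  have hinj : ∀ x y, x ∈ Γ.Y D → x ∉ Γ.ed e → y ∈ Γ.Y D → y ∉ Γ.ed e → Φ x = Φ y → x = y := by
    intro x y hx hxe hy hye hxy
    apply F.F4 hV hD he x y hx hxe hy hye
    have strict : ∀ x y, (∀ j, F.ψ j x ≤ F.ψ j y) → ∀ j, F.ψ j x < F.ψ j y → Φ x < Φ y := by
      intro x y hle j hj
      have := Summable.tsum_lt_tsum (i := j)
        (fun k => mul_le_mul_of_nonneg_left (hle k) (hw k).le)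
        (mul_lt_mul_of_pos_left hj (hw j)) (hsum x) (hsum y)
      simp only [hΦ]; linarith
    have coh : ∀ x y, x ∈ Γ.Y D → y ∈ Γ.Y D → y ∉ Γ.ed e → ∀ j k,
        (∀ z ∈ Γ.Y D, F.ψ j z ≤ F.ψ k z) → j ≠ k → F.ψ j x < F.ψ j y → F.ψ k y < F.ψ k x → False := by
      intro x y hx hy hye j k hle hjk h1 h2
      have h3 : 0 < F.ψ j y := lt_of_le_of_lt (F.ψ_mem j x).1 h1
      have h4 : F.ψ k y < 1 := lt_of_lt_of_le h2 (F.ψ_mem k x).2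
      have h5 := hle y hy
      by_cases hyj : y ∈ Γ.ed j
      · have hyk : y ∉ Γ.ed k := fun h => hjk (Subtype.ext (Γ.ed_inj hyj h))
        rcases F.F1 k y hy hye hyk with h6 | h6 <;> linarith
      · rcases F.F1 j y hy hye hyj with h6 | h6 <;> linarith
    have dich : (∀ j, F.ψ j x ≤ F.ψ j y) ∨ (∀ j, F.ψ j y ≤ F.ψ j x) := by
      by_contra hcon
      push Not at hcon
      obtain ⟨⟨k, hk⟩, ⟨j, hj⟩⟩ := hcon
      have hjk : j ≠ k := by rintro rfl; linarith
      rcases F.F3 hV hD he j k hjk with h | h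
      · exact coh x y hx hy hye j k h hjk hj hk
      · exact coh y x hy hx hxe k j h hjk.symm hk hj
    intro j
    rcases dich with h | h
    · exact le_antisymm (h j) (not_lt.1 fun hlt => (strict x y h j hlt).ne hxy)
    · exact le_antisymm (not_lt.1 fun hlt => (strict y x h j hlt).ne' hxy) (h j)
  have hsurj : ∀ r, 1 - c ≤ r → r ≤ 1 → ∃ x ∈ Γ.Y D, x ∉ Γ.ed e ∧ Φ x = r := by
    intro r hr0 hr1
    by_contra hno
    push Not at hno
    have hZ : IsClosed (Γ.Y D ∩ (Γ.ed e)ᶜ) := isClosed_closure.inter (Γ.opn e).isClosed_compl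
    obtain ⟨χ, h1, h0⟩ := sep hV (Γ.Y D ∩ (Γ.ed e)ᶜ ∩ Φ ⁻¹' Ici r) (Γ.Y D ∩ (Γ.ed e)ᶜ ∩ Φ ⁻¹' Iic r)
      (hZ.inter (isClosed_Ici.preimage hΦc)) (hZ.inter (isClosed_Iic.preimage hΦc)) (by
        rw [Set.disjoint_left]
        rintro x ⟨⟨hx, hxe⟩, hx1⟩ ⟨_, hx2⟩
        exact hno x hx hxe (le_antisymm hx2 hx1))
    have hVe : ∀ v : V, (v : X) ∉ Γ.ed e := fun v h => Γ.ed_disj_V h v.2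
    have hae : χ (Γ.a e) = 1 := h1 _ ⟨⟨Γ.Y_a he, hVe _⟩, by simpa [hΦa] using hr1⟩
    have hbe : χ (Γ.b e) = 0 := h0 _ ⟨⟨Γ.Y_b he, hVe _⟩, by simpa [hΦb] using hr0⟩
    have hpar := hD.1 χ
    rw [glPr_of_single D _ e he, cob_apply, hae, hbe] at hpar
    · exact absurd hpar (by decide)
    intro i hi hie
    rw [cob_apply, zmod2_add_eq_zero]
    have hpre : IsPreconnected (Φ '' (Γ.γ i '' Icc (0:ℝ) 1)) :=
      (isPreconnected_Icc.image _ (Γ.cont i)).image _ hΦc.continuousOn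
    have hnr : r ∉ Φ '' (Γ.γ i '' Icc (0:ℝ) 1) := by
      rintro ⟨x, hx, hxr⟩
      refine hno x (Γ.Y_Icc hi hx) ?_ hxr
      intro hxe
      rcases Γ.Icc_image_cases i hx with h | h | h
      · exact hie (Γ.ed_inj h hxe)
      · exact hVe (Γ.a i) (h ▸ hxe)
      · exact hVe (Γ.b i) (h ▸ hxe)
    have hma : Φ (Γ.a i) ∈ Φ '' (Γ.γ i '' Icc (0:ℝ) 1) := ⟨_, ⟨0, by norm_num, rfl⟩, rfl⟩
    have hmb : Φ (Γ.b i) ∈ Φ '' (Γ.γ i '' Icc (0:ℝ) 1) := ⟨_, ⟨1, by norm_num, rfl⟩, rfl⟩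
    rcases le_total (Φ (Γ.a i)) r with ha | ha <;> rcases le_total (Φ (Γ.b i)) r with hb | hb
    · rw [h0 _ ⟨⟨Γ.Y_a hi, hVe _⟩, ha⟩, h0 _ ⟨⟨Γ.Y_b hi, hVe _⟩, hb⟩]
    · exact absurd (hpre.ordConnected.out hma hmb ⟨ha, hb⟩) hnr
    · exact absurd (hpre.ordConnected.out hmb hma ⟨hb, ha⟩) hnr
    · rw [h1 _ ⟨⟨Γ.Y_a hi, hVe _⟩, ha⟩, h1 _ ⟨⟨Γ.Y_b hi, hVe _⟩, hb⟩]
  let Θ : X → Circle := fun x => if h : x ∈ Γ.ed e then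
    Circle.exp (2 * Real.pi * ((1 - c) * h.choose)) else Circle.exp (2 * Real.pi * Φ x)
  have hΘe : ∀ t ∈ Ioo (0:ℝ) 1, Θ (Γ.γ e t) = Circle.exp (2 * Real.pi * ((1 - c) * t)) := by
    intro t ht
    have h : Γ.γ e t ∈ Γ.ed e := ⟨t, ht, rfl⟩
    have := (Γ.inj _ _ _ _ h.choose_spec.1 ht h.choose_spec.2).2
    simp only [Θ, dif_pos h, this]
  have hΘo : ∀ x ∉ Γ.ed e, Θ x = Circle.exp (2 * Real.pi * Φ x) := by
    intro x hx
    simp only [Θ, dif_neg hx]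
  have hVe : ∀ v : V, (v : X) ∉ Γ.ed e := fun v h => Γ.ed_disj_V h v.2
  have hΘc : Continuous Θ := by
    rw [← continuousOn_univ]
    have hun : (univ : Set X) = (Γ.ed e)ᶜ ∪ Γ.γ e '' Icc (0:ℝ) 1 := by
      symm
      rw [eq_univ_iff_forall]
      intro x
      by_cases h : x ∈ Γ.ed e
      · exact Or.inr (image_mono Ioo_subset_Icc_self h)
      · exact Or.inl h
    rw [hun]
    apply ContinuousOn.union_of_isClosed _ _ (Γ.opn e).isClosed_compl
      (isCompact_Icc.image_of_continuousOn (Γ.cont e)).isClosed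
    · apply ContinuousOn.congr (f := fun x => Circle.exp (2 * Real.pi * Φ x))
      · exact (Circle.exp.continuous.comp (continuous_const.mul hΦc)).continuousOn
      · exact fun x hx => hΘo x hx
    · apply continuousOn_image_of_comp isCompact_Icc (Γ.cont e)
      apply ContinuousOn.congr (f := fun t : ℝ => Circle.exp (2 * Real.pi * ((1 - c) * t)))
      · exact (Circle.exp.continuous.comp (by fun_prop)).continuousOn
      · intro t ht
        show Θ (Γ.γ e t) = _
        rcases eq_or_lt_of_le ht.1 with rfl | ht0
        · have := hΘo _ (hVe (Γ.a e))
          rw [hΦa] at this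
          rw [show Γ.γ e 0 = Γ.a e from rfl, this]
          simp
        rcases eq_or_lt_of_le ht.2 with rfl | ht1
        · have := hΘo _ (hVe (Γ.b e))
          rw [hΦb] at this
          rw [show Γ.γ e 1 = Γ.b e from rfl, this]
          simp
        exact hΘe t ⟨ht0, ht1⟩
  have hmix : ∀ t ∈ Ioo (0:ℝ) 1, ∀ y ∉ Γ.ed e, Θ (Γ.γ e t) ≠ Θ y := by
    intro t ht y hy h
    rw [hΘe t ht, hΘo y hy] at h
    have h0 := hΦ0 y
    have h1 := hΦ1 y
    obtain ⟨ht0, ht1⟩ := ht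
    have hp : 0 < (1 - c) * t := mul_pos (by linarith) ht0
    have hq : (1 - c) * t < 1 - c := by nlinarith
    have := circle_exp_inj _ _ h (by linarith) (by linarith)
    linarith
  have hbij : Function.Bijective (fun x : Γ.Y D => Θ x) := by
    constructor
    · rintro ⟨x, hx⟩ ⟨y, hy⟩ hxy
      simp only at hxy
      apply Subtype.ext
      show x = y
      by_cases hxe : x ∈ Γ.ed e
      · obtain ⟨t, ht, rfl⟩ := hxe
        by_cases hye : y ∈ Γ.ed e
        · obtain ⟨s, hs, rfl⟩ := hye
          rw [hΘe t ht, hΘe s hs] at hxy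
          obtain ⟨ht0, ht1⟩ := ht
          obtain ⟨hs0, hs1⟩ := hs
          have h1 : 0 < (1 - c) * t := mul_pos (by linarith) ht0
          have h2 : (1 - c) * t < 1 - c := by nlinarith
          have h3 : 0 < (1 - c) * s := mul_pos (by linarith) hs0
          have h4 : (1 - c) * s < 1 - c := by nlinarith
          have := circle_exp_inj _ _ hxy (by linarith) (by linarith)
          have hne : (1 - c) ≠ 0 := by linarith
          rw [mul_left_cancel₀ hne this]
        · exact absurd hxy (hmix t ht y hye)
      · by_cases hye : y ∈ Γ.ed e
        · obtain ⟨s, hs, rfl⟩ := hye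
          exact absurd hxy.symm (hmix s hs x hxe)
        · rw [hΘo x hxe, hΘo y hye] at hxy
          have h1 := hΦ0 x
          have h2 := hΦ1 x
          have h3 := hΦ0 y
          have h4 := hΦ1 y
          exact hinj x y hx hxe hy hye (circle_exp_inj _ _ hxy (by linarith) (by linarith))
    · intro z
      obtain ⟨r, hr0, hr1, rfl⟩ := circle_exp_surj z
      rcases lt_or_ge r (1 - c) with h | h
      · have hpos : 0 < 1 - c := by linarith
        have ht : r / (1 - c) ∈ Ioo (0:ℝ) 1 := ⟨div_pos hr0 hpos, by rw [div_lt_one hpos]; exact h⟩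
        refine ⟨⟨Γ.γ e (r / (1 - c)), Γ.Y_ed he ⟨_, ht, rfl⟩⟩, ?_⟩
        simp only
        rw [hΘe _ ht, mul_div_cancel₀ _ hpos.ne']
      · obtain ⟨x, hx, hxe, hxr⟩ := hsurj r h hr1
        refine ⟨⟨x, hx⟩, ?_⟩
        simp only
        rw [hΘo x hxe, hxr]
  haveI : CompactSpace (Γ.Y D) := isCompact_iff_compactSpace.1 isClosed_closure.isCompact
  exact ⟨Continuous.homeoOfEquivCompactToT2 (f := Equiv.ofBijective _ hbij)
    (hΘc.comp continuous_subtype_val)⟩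
end GP
end Homeo

section Final
namespace GP
variable {V : Set X} {E : Type}

lemma end_limit [CompactSpace X] [T2Space X] (hV : IsClosed V) [TotallyDisconnectedSpace V]
    (γ : ℝ → X) (hγ : ContinuousOn γ (Ioo 0 1))
    (hR : ∀ R : Set X, IsCompact R → Disjoint R V → ∀ᶠ t in 𝓝[>] (0:ℝ), γ t ∉ R) :
    ∃ v ∈ V, Tendsto γ (𝓝[>] (0:ℝ)) (𝓝 v) := by
  have hclV : ∀ x, ClusterPt x (map γ (𝓝[>] (0:ℝ))) → x ∈ V := by
    intro x hx
    by_contra hxV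
    obtain ⟨R, hRn, hRc, hRs⟩ := exists_mem_nhds_isClosed_subset (hV.isOpen_compl.mem_nhds hxV)
    have h1 := hR R hRc.isCompact (Set.disjoint_left.2 fun y hy hyV => hRs hy hyV)
    have h2 := clusterPt_iff_frequently.1 hx R hRn
    rw [frequently_map] at h2
    obtain ⟨t, ht1, ht2⟩ := (h2.and_eventually h1).exists
    exact ht2 ht1
  obtain ⟨x, hx⟩ := exists_clusterPt_of_compactSpace (map γ (𝓝[>] (0:ℝ)))
  refine ⟨x, hclV x hx, ?_⟩
  apply le_nhds_of_unique_clusterPt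
  intro y hy
  by_contra hyx
  have hyV := hclV y hy
  have hxV := hclV x hx
  obtain ⟨χ, h1, h0⟩ := sep hV {x} {y} isClosed_singleton isClosed_singleton
    (by simpa using Ne.symm hyx)
  have hcx := h1 ⟨x, hxV⟩ rfl
  have hcy := h0 ⟨y, hyV⟩ rfl
  have hA : IsClosed (Subtype.val '' (χ ⁻¹' {0})) :=
    hV.isClosedEmbedding_subtypeVal.isClosedMap _ (χ.isLocallyConstant.isClosed_fiber 0)
  have hB : IsClosed (Subtype.val '' (χ ⁻¹' {0}ᶜ)) :=
    hV.isClosedEmbedding_subtypeVal.isClosedMap _ (χ.isLocallyConstant.isClopen_fiber 0).compl.1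
  have hd : Disjoint (Subtype.val '' (χ ⁻¹' {0})) (Subtype.val '' (χ ⁻¹' {0}ᶜ)) := by
    rw [Set.disjoint_left]
    rintro _ ⟨v, hv, rfl⟩ ⟨w, hw, hvw⟩
    rw [Subtype.val_injective hvw] at hw
    exact hw hv
  obtain ⟨U0, U1, hU0, hU1, hA0, hB1, hUU⟩ := normal_separation hA hB hd
  have hyU : y ∈ U0 := hA0 ⟨⟨y, hyV⟩, hcy, rfl⟩
  have hxU : x ∈ U1 := hB1 ⟨⟨x, hxV⟩, by simp [hcx], rfl⟩
  have hev := hR (U0 ∪ U1)ᶜ (hU0.union hU1).isClosed_compl.isCompact (by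
    rw [Set.disjoint_left]
    intro z hz hzV
    apply hz
    by_cases h : χ ⟨z, hzV⟩ = 0
    · exact Or.inl (hA0 ⟨_, h, rfl⟩)
    · exact Or.inr (hB1 ⟨_, h, rfl⟩))
  obtain ⟨δ, hδ, hδs⟩ := (mem_nhdsGT_iff_exists_Ioo_subset).1 hev
  have hδ0 : (0:ℝ) < δ := hδ
  have hsub : γ '' Ioo 0 (min δ 1) ⊆ U0 ∪ U1 := by
    rintro _ ⟨t, ⟨ht0, ht1⟩, rfl⟩
    by_contra hn
    exact hδs ⟨ht0, ht1.trans_le (min_le_left _ _)⟩ hn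
  have hpre : IsPreconnected (γ '' Ioo 0 (min δ 1)) :=
    isPreconnected_Ioo.image _ (hγ.mono (Ioo_subset_Ioo_right (min_le_right _ _)))
  have hmem : ∀ᶠ t in 𝓝[>] (0:ℝ), t ∈ Ioo 0 (min δ 1) :=
    Ioo_mem_nhdsGT (lt_min hδ0 one_pos)
  have fin : ∀ z U U', IsOpen U → Disjoint U U' → z ∈ U → ClusterPt z (map γ (𝓝[>] (0:ℝ))) →
      γ '' Ioo 0 (min δ 1) ⊆ U' → False := by
    intro z U U' hU hdd hz hcl hs
    have h2 := clusterPt_iff_frequently.1 hcl U (hU.mem_nhds hz)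
    rw [frequently_map] at h2
    obtain ⟨t, ht1, ht2⟩ := (h2.and_eventually hmem).exists
    exact Set.disjoint_left.1 hdd ht1 (hs ⟨t, ht2, rfl⟩)
  rcases hpre.subset_or_subset hU0 hU1 hUU hsub with h | h
  · exact fin x U1 U0 hU1 hUU.symm hxU hx h
  · exact fin y U0 U1 hU0 hUU hyU hy h

lemma gp_exists [CompactSpace X] [T2Space X] (hV : IsClosed V) [TotallyDisconnectedSpace V]
    [TopologicalSpace E] [DiscreteTopology E] (H : (Vᶜ : Set X) ≃ₜ E × ↥(Ioo (0:ℝ) 1)) :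
    Nonempty (GP X V E) := by
  classical
  let γ0 : E → ℝ → X := fun i t => if h : t ∈ Ioo (0:ℝ) 1 then (H.symm (i, ⟨t, h⟩) : X) else
    (H.symm (i, ⟨1/2, by norm_num⟩) : X)
  have hγ0 : ∀ i t (h : t ∈ Ioo (0:ℝ) 1), γ0 i t = (H.symm (i, ⟨t, h⟩) : X) := by
    intro i t h; simp only [γ0, dif_pos h]
  have hc : ∀ i, ContinuousOn (γ0 i) (Ioo 0 1) := by
    intro i
    rw [continuousOn_iff_continuous_restrict]
    have : (Ioo (0:ℝ) 1).domRestrict (γ0 i) = fun t => (H.symm (i, t) : X) := by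
      ext t; exact hγ0 i t t.2
    rw [this]
    exact continuous_subtype_val.comp (H.symm.continuous.comp (by fun_prop))
  have hR : ∀ R : Set X, IsCompact R → Disjoint R V → ∃ T : Set ℝ, IsClosed T ∧ T ⊆ Ioo 0 1 ∧
      ∀ i, ∀ t ∈ Ioo (0:ℝ) 1, γ0 i t ∈ R → t ∈ T := by
    intro R hRc hRV
    have hR' : IsCompact ((Subtype.val : (Vᶜ : Set X) → X) ⁻¹' R) := by
      rw [Subtype.isCompact_iff, Subtype.image_preimage_coe, inter_eq_right.2]
      · exact hRc
      · exact fun x hx hxV => Set.disjoint_left.1 hRV hx hxV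
    refine ⟨(fun x => ((H x).2 : ℝ)) '' ((Subtype.val : (Vᶜ : Set X) → X) ⁻¹' R),
      (hR'.image (by fun_prop)).isClosed, ?_, ?_⟩
    · rintro _ ⟨x, _, rfl⟩; exact (H x).2.2
    · intro i t ht htR
      refine ⟨H.symm (i, ⟨t, ht⟩), ?_, by simp⟩
      show ((H.symm (i, ⟨t, ht⟩) : (Vᶜ : Set X)) : X) ∈ R
      rw [← hγ0]; exact htR
  have hlim0 : ∀ i, ∃ v ∈ V, Tendsto (γ0 i) (𝓝[>] (0:ℝ)) (𝓝 v) := by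
    intro i
    apply end_limit hV _ (hc i)
    intro R hRc hRV
    obtain ⟨T, hT, hTs, hTR⟩ := hR R hRc hRV
    have h0 : Tᶜ ∈ 𝓝 (0:ℝ) := hT.isOpen_compl.mem_nhds fun h => by simpa using (hTs h).1
    filter_upwards [mem_nhdsWithin_of_mem_nhds h0, Ioo_mem_nhdsGT one_pos] with t h1 h2 h3
    exact h1 (hTR i t h2 h3)
  have hlim1 : ∀ i, ∃ v ∈ V, Tendsto (γ0 i) (𝓝[<] (1:ℝ)) (𝓝 v) := by
    intro i
    obtain ⟨v, hv, hl⟩ := end_limit hV (fun t => γ0 i (1 - t)) ((hc i).comp (by fun_prop) (by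
      intro t ht; exact ⟨by linarith [ht.2], by linarith [ht.1]⟩)) (by
      intro R hRc hRV
      obtain ⟨T, hT, hTs, hTR⟩ := hR R hRc hRV
      have h0 : (fun t : ℝ => 1 - t) ⁻¹' Tᶜ ∈ 𝓝 (0:ℝ) :=
        (hT.isOpen_compl.preimage (by fun_prop)).mem_nhds fun h => by simpa using (hTs h).2
      filter_upwards [mem_nhdsWithin_of_mem_nhds h0, Ioo_mem_nhdsGT one_pos] with t h1 h2 h3
      exact h1 (hTR i (1 - t) ⟨by linarith [h2.2], by linarith [h2.1]⟩ h3))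
    refine ⟨v, hv, ?_⟩
    have hm : Tendsto (fun t : ℝ => 1 - t) (𝓝[<] (1:ℝ)) (𝓝[>] (0:ℝ)) := by
      apply tendsto_nhdsWithin_of_tendsto_nhds_of_eventually_within
      · have : Tendsto (fun t : ℝ => 1 - t) (𝓝 1) (𝓝 (1 - 1)) := by
          apply Continuous.tendsto; fun_prop
        rw [sub_self] at this
        exact this.mono_left nhdsWithin_le_nhds
      · filter_upwards [self_mem_nhdsWithin] with t ht
        have : t < 1 := ht
        show (0:ℝ) < 1 - t
        linarith
    have := hl.comp hm
    refine this.congr fun t => ?_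
    simp
  choose v0 hv0 hl0 using hlim0
  choose v1 hv1 hl1 using hlim1
  have hg : ∀ i, ∀ t, (h : t ∈ Ioo (0:ℝ) 1) → extendFrom (Ioo (0:ℝ) 1) (γ0 i) t = H.symm (i, ⟨t, h⟩) := by
    intro i t h
    rw [← hγ0]
    exact extendFrom_extends (hc i) t h
  refine ⟨{ γ := fun i => extendFrom (Ioo (0:ℝ) 1) (γ0 i)
            cont := fun i => continuousOn_Icc_extendFrom_Ioo (hc i) (hl0 i) (hl1 i)
            left := fun i => ?_
            right := fun i => ?_
            mid := ?_
            cov := ?_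
            inj := ?_
            opn := ?_ }⟩
  · rw [eq_lim_at_left_extendFrom_Ioo (by norm_num) (hl0 i)]; exact hv0 i
  · rw [eq_lim_at_right_extendFrom_Ioo (by norm_num) (hl1 i)]; exact hv1 i
  · intro i t ht
    simp only [hg i t ht]
    exact (H.symm (i, ⟨t, ht⟩)).2
  · intro x hx
    refine ⟨(H ⟨x, hx⟩).1, (H ⟨x, hx⟩).2, (H ⟨x, hx⟩).2.2, ?_⟩
    simp only [hg _ _ (H ⟨x, hx⟩).2.2]
    simp
  · intro i j t s ht hs h
    simp only [hg _ _ ht, hg _ _ hs] at h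
    have := H.symm.injective (Subtype.val_injective h)
    simpa using this
  · intro i
    have : extendFrom (Ioo (0:ℝ) 1) (γ0 i) '' Ioo (0:ℝ) 1 =
        Subtype.val '' (H ⁻¹' (Prod.fst ⁻¹' {i})) := by
      ext x
      constructor
      · rintro ⟨t, ht, rfl⟩
        refine ⟨H.symm (i, ⟨t, ht⟩), by simp, (hg i t ht).symm⟩
      · rintro ⟨y, hy, rfl⟩
        refine ⟨(H y).2, (H y).2.2, ?_⟩
        rw [hg _ _ (H y).2.2]
        have : i = (H y).1 := hy.symm
        subst this
        simp
    rw [this]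
    apply hV.isOpen_compl.isOpenMap_subtype_val
    exact (((isOpen_discrete {i}).preimage continuous_fst).preimage H.continuous)

variable (Γ : GP X V E)

lemma comp_eq {i : E} {x : X} (hx : x ∈ Γ.ed i) : connectedComponentIn Vᶜ x = Γ.ed i := by
  apply subset_antisymm
  · have hpre := isPreconnected_connectedComponentIn (F := Vᶜ) (x := x)
    have hxV : x ∈ Vᶜ := Γ.ed_disj_V hx
    apply hpre.subset_left_of_subset_union (v := ⋃ j ∈ {j | j ≠ i}, Γ.ed j) (Γ.opn i)
      (isOpen_biUnion fun j _ => Γ.opn j)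
    · rw [Set.disjoint_left]
      intro y hy hy2
      obtain ⟨j, hj, hyj⟩ := mem_iUnion₂.1 hy2
      exact hj (Γ.ed_inj hyj hy)
    · intro y hy
      obtain ⟨j, t, ht, rfl⟩ := Γ.cov y (connectedComponentIn_subset _ _ hy)
      by_cases hj : j = i
      · subst hj; exact Or.inl ⟨t, ht, rfl⟩
      · exact Or.inr (mem_iUnion₂.2 ⟨j, hj, t, ht, rfl⟩)
    · exact ⟨x, mem_connectedComponentIn hxV, hx⟩
  · apply IsPreconnected.subset_connectedComponentIn _ hx (fun y hy => Γ.ed_disj_V hy)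
    exact isPreconnected_Ioo.image _ ((Γ.cont i).mono Ioo_subset_Icc_self)

lemma ed_injective : Function.Injective Γ.ed := by
  intro i j h
  obtain ⟨x, hx⟩ := Γ.ed_nonempty i
  exact Γ.ed_inj hx (h ▸ hx)

lemma Y_ed_iff {D : Set E} {i : E} : Γ.ed i ⊆ Γ.Y D ↔ i ∈ D := by
  refine ⟨fun h => ?_, fun h => Γ.Y_ed h⟩
  obtain ⟨x, hx⟩ := Γ.ed_nonempty i
  rcases Γ.Y_cases (h hx) with h1 | ⟨j, hj, hxj⟩
  · exact absurd h1 (Γ.ed_disj_V hx)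
  · rwa [Γ.ed_inj hx hxj]

lemma countable_E (Γ : GP X V E) [CompactSpace X] [TopologicalSpace.MetrizableSpace X] : Countable E := by
  letI := TopologicalSpace.metrizableSpaceMetric X
  apply Pairwise.countable_of_isOpen_disjoint (s := Γ.ed)
  · intro i j hij
    rw [Function.onFun, Set.disjoint_left]
    exact fun x hx hxj => hij (Γ.ed_inj hx hxj)
  · exact Γ.opn
  · exact Γ.ed_nonempty

end GP

lemma GraphLike.isEdge_iff (G : GraphLike X) (Γ : GP X G.V G.E) (e : Set X) :
    G.IsEdge e ↔ ∃ i, e = Γ.ed i := by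
  constructor
  · rintro ⟨x, hx, rfl⟩
    obtain ⟨i, t, ht, rfl⟩ := Γ.cov x hx
    exact ⟨i, Γ.comp_eq ⟨t, ht, rfl⟩⟩
  · rintro ⟨i, rfl⟩
    obtain ⟨x, hx⟩ := Γ.ed_nonempty i
    exact ⟨x, Γ.ed_disj_V hx, (Γ.comp_eq hx).symm⟩

lemma GraphLike.even_univ [CompactSpace X] [T2Space X] (G : GraphLike X) (Γ : GP X G.V G.E)
    (h : ∀ S : G.Separation, G.EvenCut S.A S.B) : glEv (Γ.cob G.closedV) Set.univ := by
  intro φ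
  have hA : IsClosed (Subtype.val '' (φ ⁻¹' {0})) :=
    G.closedV.isClosedEmbedding_subtypeVal.isClosedMap _ (φ.isLocallyConstant.isClosed_fiber 0)
  have hB : IsClosed (Subtype.val '' (φ ⁻¹' {0}ᶜ)) :=
    G.closedV.isClosedEmbedding_subtypeVal.isClosedMap _
      (φ.isLocallyConstant.isClopen_fiber 0).compl.1
  have e1 : G.V \ (Subtype.val '' (φ ⁻¹' {0})) = Subtype.val '' (φ ⁻¹' {0}ᶜ) := by
    ext x; by_cases hx : x ∈ G.V <;> simp [hx]
  have e2 : G.V \ (Subtype.val '' (φ ⁻¹' {0}ᶜ)) = Subtype.val '' (φ ⁻¹' {0}) := by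
    ext x; by_cases hx : x ∈ G.V <;> simp [hx]
  have s1 : Subtype.val '' (φ ⁻¹' {0}) ⊆ G.V := by rintro _ ⟨v, _, rfl⟩; exact v.2
  have s2 : Subtype.val '' (φ ⁻¹' {0}ᶜ) ⊆ G.V := by rintro _ ⟨v, _, rfl⟩; exact v.2
  let S : G.Separation :=
    { A := Subtype.val '' (φ ⁻¹' {0})
      B := Subtype.val '' (φ ⁻¹' {0}ᶜ)
      clopenA := ⟨s1, hA, by rw [e1]; exact hB⟩
      clopenB := ⟨s2, hB, by rw [e2]; exact hA⟩
      disjoint := by rw [← e1, Set.inter_diff_self]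
      union := by rw [← e1, Set.union_diff_cancel s1] }
  have hcut : G.cut S.A S.B = Γ.ed '' ((Γ.cob G.closedV φ).support : Set G.E) := by
    have hcl : ∀ i (K : Set G.V), (closure (Γ.ed i) ∩ Subtype.val '' K).Nonempty ↔
        Γ.a i ∈ K ∨ Γ.b i ∈ K := by
      intro i K
      rw [Γ.closure_ed]
      constructor
      · rintro ⟨_, hx, v, hv, rfl⟩
        rcases Γ.Icc_image_cases i hx with h | h | h
        · exact absurd v.2 (Γ.ed_disj_V h)
        · left; rwa [← Subtype.val_injective h]
        · right; rwa [← Subtype.val_injective h]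
      · rintro (h | h)
        · exact ⟨Γ.a i, ⟨0, by norm_num, rfl⟩, _, h, rfl⟩
        · exact ⟨Γ.b i, ⟨1, by norm_num, rfl⟩, _, h, rfl⟩
    ext e
    simp only [GraphLike.cut, G.isEdge_iff Γ]
    constructor
    · rintro ⟨⟨i, rfl⟩, h1, h2⟩
      refine ⟨i, ?_, rfl⟩
      have h1 := (hcl i _).1 h1
      have h2 := (hcl i _).1 h2
      simp only [Finset.mem_coe, Finsupp.mem_support_iff, Γ.cob_apply, ne_eq, GP.zmod2_add_eq_zero]
      simp only [mem_preimage, mem_singleton_iff, mem_compl_iff] at h1 h2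
      intro h3
      rw [h3] at h1 h2
      tauto
    · rintro ⟨i, hi, rfl⟩
      simp only [Finset.mem_coe, Finsupp.mem_support_iff, Γ.cob_apply, ne_eq,
        GP.zmod2_add_eq_zero] at hi
      refine ⟨⟨i, rfl⟩, (hcl i _).2 ?_, (hcl i _).2 ?_⟩
      · simp only [mem_preimage, mem_singleton_iff]
        rcases zmod2_cases (φ (Γ.a i)) with h1 | h1 <;> rcases zmod2_cases (φ (Γ.b i)) with h2 | h2 <;>
          rw [h1, h2] at hi ⊢ <;> simp at hi ⊢
      · simp only [mem_preimage, mem_singleton_iff, mem_compl_iff]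
        rcases zmod2_cases (φ (Γ.a i)) with h1 | h1 <;> rcases zmod2_cases (φ (Γ.b i)) with h2 | h2 <;>
          rw [h1, h2] at hi ⊢ <;> simp at hi ⊢
  have hev := (h S).2
  rw [hcut, Set.ncard_image_of_injective _ Γ.ed_injective, Set.ncard_coe_finset] at hev
  rw [glPr_apply, Finset.sum_congr rfl (g := fun _ => (1 : ZMod 2))]
  · rw [Finset.sum_const, nsmul_eq_mul, mul_one]
    exact (ZMod.natCast_eq_zero_iff_even).2 hev
  · intro i hi
    rw [Finsupp.mem_support_iff] at hi
    simp [(zmod2_cases _).resolve_left hi]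

end Final

/-- A graph-like continuum all of whose cuts are even decomposes into
edge-disjoint circles: there is a family of circles such that every edge lies in exactly
one of them. -/
theorem decomposition_into_circles
    [CompactSpace X] [TopologicalSpace.MetrizableSpace X] [ConnectedSpace X]
    (G : GraphLike X) (h : ∀ S : G.Separation, G.EvenCut S.A S.B) :
    ∃ (ι : Type) (C : ι → Set X),
      (∀ i, Nonempty (C i ≃ₜ Circle)) ∧
      ∀ e, G.IsEdge e → ∃! i, e ⊆ C i := by
  haveI := G.zeroDimV
  obtain ⟨Γ⟩ : Nonempty (GP X G.V G.E) := by
    letI : TopologicalSpace G.E := ⊥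
    haveI : DiscreteTopology G.E := ⟨rfl⟩
    obtain ⟨H⟩ := G.homeo
    exact GP.gp_exists G.closedV H
  haveI := Γ.countable_E
  obtain ⟨𝒟, hc, hu⟩ := glCirc_decomp (Γ.cob G.closedV) (G.even_univ Γ h)
  refine ⟨𝒟, fun D => Γ.Y D, fun D => Γ.circuit_circle G.closedV (hc D D.2), ?_⟩
  intro e he
  obtain ⟨i, rfl⟩ := (G.isEdge_iff Γ e).1 he
  obtain ⟨D, ⟨hD, hi⟩, huniq⟩ := hu i
  refine ⟨⟨D, hD⟩, Γ.Y_ed_iff.2 hi, ?_⟩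
  rintro ⟨D', hD'⟩ h'
  exact Subtype.ext (huniq D' ⟨hD', Γ.Y_ed_iff.1 h'⟩)
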